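/- arXiv:1310.0409 — 3 statements merged into one kernel-verified Lean document; each statement's English description precedes it below -/
import Mathlib

section
/- Let X be a topological space with points G_δ (every singleton is the intersection of countably many open sets). Then for every compact subset K ⊆ X there is a family 𝒰 of open subsets of X with |𝒰| ≤ 2^{ℵ₀} such that K = ⋂𝒰. -/
open Cardinal Set

/-- `X` has points `G_δ`: every singleton is the intersection of countably many open sets. -/
def PointsGDelta (X : Type*) [TopologicalSpace X] : Prop :=
  ∀ x : X, ∃ 𝒰 : ℕ → Set X, (∀ n, IsOpen (𝒰 n)) ∧ (⋂ n, 𝒰 n) = {x}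

/-- In a compact space with points `G_δ`, a set in which every sequence has a cluster point
is compact. -/
theorem PointsGDelta.isCompact_of_mapClusterPt {X : Type*} [TopologicalSpace X] [CompactSpace X]
    (hGδ : PointsGDelta X) {H : Set X}
    (hH : ∀ s : ℕ → X, (∀ n, s n ∈ H) → ∃ h ∈ H, MapClusterPt h Filter.atTop s) :
    IsCompact H := by
  by_contra hnc
  obtain ⟨C₀, hC₀open, hC₀cov, hC₀fin⟩ : ∃ C₀ : Set (Set X), (∀ U ∈ C₀, IsOpen U) ∧ H ⊆ ⋃₀ C₀ ∧
      ∀ t ⊆ C₀, t.Finite → ¬ H ⊆ ⋃₀ t := by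
    by_contra! hcon
    refine hnc (isCompact_of_finite_subcover fun {ι} U hU hHU => ?_)
    obtain ⟨t, ht, htfin, hHt⟩ := hcon (range U) (by rintro _ ⟨i, rfl⟩; exact hU i)
      (by rwa [sUnion_range])
    obtain ⟨u, -, hu, hHu⟩ := (exists_subset_image_finite_and (p := fun t => H ⊆ ⋃₀ t)).1
      ⟨t, image_univ (f := U) ▸ ht, htfin, hHt⟩
    exact ⟨hu.toFinset, by simpa [sUnion_image] using hHu⟩
  obtain ⟨C, hC₀C, hC⟩ := zorn_subset_nonempty
    {C : Set (Set X) | (∀ U ∈ C, IsOpen U) ∧ ∀ t ⊆ C, t.Finite → ¬ H ⊆ ⋃₀ t}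
    (fun c hc hchain hne => by
      refine ⟨⋃₀ c, ⟨fun U ⟨D, hD, hU⟩ => (hc hD).1 U hU, fun t ht htfin => ?_⟩,
        fun D hD => subset_sUnion_of_mem hD⟩
      obtain ⟨D, hD, htD⟩ := hchain.directedOn.exists_mem_subset_of_finite_of_subset_sUnion
        hne htfin ht
      exact (hc hD).2 t htD htfin)
    C₀ ⟨hC₀open, hC₀fin⟩
  obtain ⟨p, hp⟩ : ∃ p, p ∉ ⋃₀ C := by
    by_contra! hall
    obtain ⟨t, ht, htfin, hcov⟩ := isCompact_univ.elim_finite_subcover_image (c := id) hC.prop.1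
      (fun x _ => by simpa using hall x)
    exact hC.prop.2 t ht htfin ((subset_univ _).trans (by simpa [sUnion_eq_biUnion] using hcov))
  have hpH : p ∉ H := fun h => hp (sUnion_mono hC₀C (hC₀cov h))
  obtain ⟨U, hUopen, hUp⟩ := hGδ p
  have hpU : ∀ n, p ∈ U n := mem_iInter.1 (hUp ▸ mem_singleton p)
  have key : ∀ n, ∃ t ⊆ C, t.Finite ∧ H ⊆ U n ∪ ⋃₀ t := by
    intro n
    by_contra! hcon
    have hmem : insert (U n) C ⊆ C := hC.le_of_ge
      ⟨fun V hV => hV.elim (fun h => h ▸ hUopen n) (hC.prop.1 V), fun t ht htfin hHt =>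
        hcon (t \ {U n}) (by simpa [sdiff_singleton_subset_iff] using ht) htfin.sdiff
          (hHt.trans (by
            rw [← sUnion_insert]
            exact sUnion_mono (by simp)))⟩
      (subset_insert _ _)
    exact hp ⟨U n, hmem (mem_insert _ _), hpU n⟩
  choose t htC htfin htcov using key
  have hseq : ∀ N, ∃ x ∈ H, ∀ n ≤ N, x ∉ ⋃₀ t n := by
    intro N
    have := hC.prop.2 (⋃ n ∈ Iic N, t n) (iUnion₂_subset fun n _ => htC n)
      ((finite_Iic N).biUnion fun n _ => htfin n)
    obtain ⟨x, hxH, hx⟩ := not_subset.1 this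
    exact ⟨x, hxH, fun n hn ⟨V, hV, hxV⟩ => hx ⟨V, mem_biUnion (mem_Iic.2 hn) hV, hxV⟩⟩
  choose s hsH hs using hseq
  obtain ⟨h, hhH, hclus⟩ := hH s hsH
  obtain ⟨n, hn⟩ : ∃ n, h ∉ U n := by
    by_contra! hall
    have : h ∈ ({p} : Set X) := hUp ▸ mem_iInter.2 hall
    exact hpH (mem_singleton_iff.1 this ▸ hhH)
  have hht : h ∈ ⋃₀ t n := (htcov n hhH).resolve_left hn
  have hopen : IsOpen (⋃₀ t n) := isOpen_sUnion fun V hV => hC.prop.1 V (htC n hV)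
  obtain ⟨N, hN, hsN⟩ := ((hclus.frequently (hopen.mem_nhds hht)).and_eventually
    (Filter.eventually_ge_atTop n)).exists
  exact hs N n hsN hN

/-- The arities of the operations used in `PointsGDelta.mk_le_continuum`: one of countable arity,
and one of arity `l.length` for each list `l` of natural numbers. -/
def closingArity : Option (List ℕ) → Type
  | none => ℕ
  | some l => Fin l.length

theorem mk_wType_closingArity_le : #(WType closingArity) ≤ 𝔠 := by
  refine WType.cardinalMk_le_of_le' ?_
  simp only [Cardinal.lift_id]
  calc Cardinal.sum (fun a => 𝔠 ^ #(closingArity a))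
      ≤ Cardinal.sum (fun _ : Option (List ℕ) => 𝔠) := by
        refine Cardinal.sum_le_sum _ _ fun a => ?_
        have : #(closingArity a) ≤ ℵ₀ := by
          cases a with
          | none => exact Cardinal.mk_nat.le
          | some l => exact (Cardinal.mk_fin l.length).trans_le (Cardinal.natCast_le_aleph0)
        exact (Cardinal.power_le_power_left continuum_ne_zero this).trans
          continuum_power_aleph0.le
    _ ≤ 𝔠 := by
        rw [Cardinal.sum_const', mk_eq_aleph0 (Option (List ℕ)), aleph0_mul_continuum]

/-- **Gryzlov's theorem**: a compact space with points `G_δ` has at most continuum many points. -/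
theorem PointsGDelta.mk_le_continuum {X : Type*} [TopologicalSpace X] [CompactSpace X]
    (hGδ : PointsGDelta X) : #X ≤ 𝔠 := by
  rcases isEmpty_or_nonempty X with hX | hX
  · simp
  have hlim : ∀ s : ℕ → X, ∃ h, MapClusterPt h Filter.atTop s := fun s =>
    let ⟨h, _, hh⟩ := isCompact_univ (f := Filter.map s Filter.atTop) (by simp)
    ⟨h, hh⟩
  choose lim hlim using hlim
  have hGδ' := hGδ
  choose U hUopen hU using hGδ'
  have hout : ∀ V : Set X, ∃ x, V ≠ Set.univ → x ∉ V := by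
    intro V
    by_cases hV : V = Set.univ
    · exact ⟨Classical.arbitrary X, fun h => (h hV).elim⟩
    · exact ((ne_univ_iff_exists_notMem V).1 hV).imp fun _ h _ => h
  choose out hout using hout
  let step : (Σ a, closingArity a → X) → X
    | ⟨none, s⟩ => lim s
    | ⟨some l, s⟩ => out (⋃ i : Fin l.length, U (s i) (l.get i))
  let ev : WType closingArity → X := WType.elim X step
  have hcpt : IsCompact (range ev) := by
    refine hGδ.isCompact_of_mapClusterPt fun s hs => ?_
    choose w hw using hs
    refine ⟨lim s, ⟨WType.mk none w, ?_⟩, hlim s⟩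
    change lim (fun n => ev (w n)) = lim s
    rw [funext hw]
  have hsurj : range ev = Set.univ := by
    by_contra hne
    obtain ⟨y, hy⟩ := (ne_univ_iff_exists_notMem _).1 hne
    have hsep : ∀ w, ∃ n, y ∉ U (ev w) n := by
      intro w
      by_contra! hall
      have : y ∈ ({ev w} : Set X) := hU (ev w) ▸ mem_iInter.2 hall
      exact hy ⟨w, (mem_singleton_iff.1 this).symm⟩
    choose n hn using hsep
    obtain ⟨t, ht⟩ := hcpt.elim_finite_subcover (fun w => U (ev w) (n w))
      (fun w => hUopen _ _) (by
        rintro _ ⟨w, rfl⟩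
        exact mem_iUnion.2 ⟨w, mem_iInter.1 (hU (ev w) ▸ mem_singleton (ev w)) _⟩)
    let L := t.toList
    have hlen : (L.map n).length = L.length := List.length_map _
    let w₀ : WType closingArity := WType.mk (some (L.map n)) fun i => L.get (Fin.cast hlen i)
    let V : Set X := ⋃ i : Fin (L.map n).length,
      U (ev (L.get (Fin.cast hlen i))) ((L.map n).get i)
    have hget : ∀ i : Fin (L.map n).length, (L.map n).get i = n (L.get (Fin.cast hlen i)) := by
      intro i
      simp
    have hyV : y ∉ V := by
      simp only [V, mem_iUnion, not_exists, hget]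
      exact fun i => hn _
    have hev : ev w₀ ∉ V := hout V (fun h => hyV (h ▸ mem_univ y))
    obtain ⟨w, hwt, hw⟩ := mem_iUnion₂.1 (ht ⟨w₀, rfl⟩)
    obtain ⟨i, hi⟩ := List.get_of_mem (Finset.mem_toList.2 hwt)
    refine hev (mem_iUnion.2 ⟨Fin.cast hlen.symm i, ?_⟩)
    rw [hget]
    change ev w₀ ∈ U (ev (L.get i)) (n (L.get i))
    rw [hi]
    exact hw
  have h := Cardinal.mk_range_le_lift (f := ev)
  rw [hsurj, mk_univ] at h
  have h' := h.trans (Cardinal.lift_le.2 mk_wType_closingArity_le)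
  simpa using h'

theorem PointsGDelta.subtype {X : Type*} [TopologicalSpace X] (hGδ : PointsGDelta X)
    (K : Set X) : PointsGDelta K := by
  intro x
  obtain ⟨U, hUopen, hU⟩ := hGδ x
  refine ⟨fun n => Subtype.val ⁻¹' U n, fun n => (hUopen n).preimage continuous_subtype_val, ?_⟩
  rw [← preimage_iInter, hU]
  ext y
  simp [Subtype.ext_iff]

/-- If `X` has points `G_δ`, then every compact `K ⊆ X` is the intersection of a family of
at most continuum many open sets. -/
theorem stmt4 {X : Type*} [TopologicalSpace X]
    (hGδ : PointsGDelta X) (K : Set X) (hK : IsCompact K) :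
    ∃ 𝒰 : Set (Set X), (∀ U ∈ 𝒰, IsOpen U) ∧ #𝒰 ≤ Cardinal.continuum ∧ K = ⋂₀ 𝒰 := by
  have hcard : #K ≤ 𝔠 := by
    have := isCompact_iff_compactSpace.1 hK
    exact (hGδ.subtype K).mk_le_continuum
  have hGδ' := hGδ
  choose U hUopen hU using hGδ'
  let W : Finset (K × ℕ) → Set X := fun t => ⋃ p ∈ t, U p.1 p.2
  refine ⟨{V | V ∈ range W ∧ K ⊆ V}, ?_, ?_, ?_⟩
  · rintro _ ⟨⟨t, rfl⟩, -⟩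
    exact isOpen_biUnion fun p _ => hUopen _ _
  · have hprod : #(K × ℕ) ≤ 𝔠 := by
      rw [Cardinal.mk_prod]
      simpa using mul_le_mul' hcard (le_refl ℵ₀)
    have hfin : #(Finset (K × ℕ)) ≤ 𝔠 := by
      rcases finite_or_infinite (K × ℕ) with h | h
      · exact (Cardinal.lt_aleph0_of_finite _).le.trans aleph0_le_continuum
      · rwa [Cardinal.mk_finset_of_infinite]
    exact ((Cardinal.mk_le_mk_of_subset fun V hV => hV.1).trans Cardinal.mk_range_le).trans hfin
  · refine Subset.antisymm (subset_sInter fun V hV => hV.2) fun y hy => ?_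
    by_contra hyK
    have hsep : ∀ x : K, ∃ n, y ∉ U x n := by
      intro x
      by_contra! hall
      have : y ∈ ({(x : X)} : Set X) := hU x ▸ mem_iInter.2 hall
      exact hyK (mem_singleton_iff.1 this ▸ x.2)
    choose n hn using hsep
    obtain ⟨t, ht⟩ := hK.elim_finite_subcover (fun x : K => U x (n x)) (fun x => hUopen _ _)
      (fun x hx => mem_iUnion.2 ⟨⟨x, hx⟩, mem_iInter.1 (hU x ▸ mem_singleton x) _⟩)
    classical
    have hWt : W (t.image fun x => (x, n x)) = ⋃ x ∈ t, U x (n x) := by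
      exact Finset.set_biUnion_finset_image
    have := hy _ ⟨⟨_, rfl⟩, hWt ▸ ht⟩
    rw [hWt] at this
    obtain ⟨x, -, hx⟩ := mem_iUnion₂.1 this
    exact hn x hx
end

section
/- Let X be a topological space and κ an infinite cardinal. Then player II has a winning strategy in the game G₁^κ(𝒦,𝒪) on X if and only if player I has a winning strategy in the compact-open game of length κ on X. -/
open Cardinal Set

/-- `C` is an open cover of the space `X`: a family of open sets whose union is `X`. -/
def IsOpenCover {X : Type*} [TopologicalSpace X] (C : Set (Set X)) : Prop :=
  (∀ U ∈ C, IsOpen U) ∧ ⋃₀ C = Set.univ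

/-- `C` is a `K`-cover of `X`: an open cover such that every compact subset of `X` is
contained in some member of `C`. -/
def IsKCover {X : Type*} [TopologicalSpace X] (C : Set (Set X)) : Prop :=
  IsOpenCover C ∧ ∀ K : Set X, IsCompact K → ∃ U ∈ C, K ⊆ U

/-- Player II has a winning strategy in the game `G₁^len(𝒦,𝒪)` on `X`. -/
def PlayerIIWinsG1KO (X : Type*) [TopologicalSpace X] (len : Ordinal) : Prop :=
  ∃ F : (ξ : Ordinal) → ξ < len → ((η : Ordinal) → η ≤ ξ → Set (Set X)) → Set X,
    (∀ (ξ : Ordinal) (hξ : ξ < len) (h : (η : Ordinal) → η ≤ ξ → Set (Set X)),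
      (∀ η hη, IsKCover (h η hη)) → F ξ hξ h ∈ h ξ le_rfl) ∧
    (∀ U : Ordinal → Set (Set X), (∀ ξ < len, IsKCover (U ξ)) →
      ⋃₀ {V | ∃ ξ, ∃ hξ : ξ < len, V = F ξ hξ fun η _ => U η} = Set.univ)

/-- Player I has a winning strategy in the compact-open game of length `len` on `X`:
there is a strategy `S` assigning to each sequence `(U_η)_{η<ξ}` of open sets (the previous
moves of player II) a compact subset of `X`, such that for every play in which player II
responds to each compact set with an open superset, the open sets chosen by player II
cover `X`. -/
def PlayerIWinsCompactOpen (X : Type*) [TopologicalSpace X] (len : Ordinal) : Prop :=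
  ∃ S : (ξ : Ordinal) → ξ < len → ((η : Ordinal) → η < ξ → Set X) → Set X,
    (∀ (ξ : Ordinal) (hξ : ξ < len) (h : (η : Ordinal) → η < ξ → Set X),
      IsCompact (S ξ hξ h)) ∧
    (∀ U : Ordinal → Set X,
      (∀ (ξ : Ordinal) (hξ : ξ < len),
        IsOpen (U ξ) ∧ S ξ hξ (fun η _ => U η) ⊆ U ξ) →
      (⋃ ξ : Ordinal, ⋃ _ : ξ < len, U ξ) = Set.univ)

/-- The sequence defined by transfinite recursion whose `ξ`-th term is computed by `G` from the
previous terms and the parameter `p ξ`. -/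
noncomputable def recSeq {β γ : Type*} (G : (ξ : Ordinal) → ((η : Ordinal) → η < ξ → γ) → β → γ)
    (p : Ordinal → β) (ξ : Ordinal) : γ :=
  G ξ (fun η _ => recSeq G p η) (p ξ)
termination_by ξ

theorem recSeq_eq {β γ : Type*} (G : (ξ : Ordinal) → ((η : Ordinal) → η < ξ → γ) → β → γ)
    (p : Ordinal → β) (ξ : Ordinal) :
    recSeq G p ξ = G ξ (fun η _ => recSeq G p η) (p ξ) := by
  rw [recSeq]

theorem recSeq_congr {β γ : Type*} (G : (ξ : Ordinal) → ((η : Ordinal) → η < ξ → γ) → β → γ)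
    {p q : Ordinal → β} (ξ : Ordinal) (h : ∀ η ≤ ξ, p η = q η) :
    recSeq G p ξ = recSeq G q ξ := by
  induction ξ using WellFoundedLT.induction with
  | _ ξ ih =>
    rw [recSeq_eq G p, recSeq_eq G q, h ξ le_rfl]
    congr 1
    funext η hη
    exact ih η hη fun ζ hζ => h ζ (hζ.trans hη.le)

section Games

variable {X : Type*} [TopologicalSpace X]

theorem isKCover_singleton_univ : IsKCover ({Set.univ} : Set (Set X)) := by
  refine ⟨⟨?_, by simp⟩, fun K _ => ⟨Set.univ, rfl, Set.subset_univ K⟩⟩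
  rintro U rfl
  exact isOpen_univ

theorem isKCover_range {u : {K : Set X // IsCompact K} → Set X} (hopen : ∀ K, IsOpen (u K))
    (hsub : ∀ K, K.1 ⊆ u K) : IsKCover (Set.range u) := by
  refine ⟨⟨?_, ?_⟩, fun K hK => ⟨u ⟨K, hK⟩, ⟨_, rfl⟩, hsub ⟨K, hK⟩⟩⟩
  · rintro _ ⟨K, rfl⟩
    exact hopen K
  · refine Set.eq_univ_of_forall fun x => ?_
    exact ⟨u ⟨{x}, isCompact_singleton⟩, ⟨_, rfl⟩, hsub ⟨{x}, isCompact_singleton⟩ rfl⟩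

/-- If `f` selects a member of every `K`-cover, then some compact set has the property that each of
its open supersets is selected by `f` from some `K`-cover. -/
theorem exists_isCompact_forall_exists_isKCover (f : Set (Set X) → Set X)
    (hf : ∀ C, IsKCover C → f C ∈ C) :
    ∃ K : Set X, IsCompact K ∧ ∀ U, IsOpen U → K ⊆ U → ∃ C, IsKCover C ∧ f C = U := by
  by_contra! hcon
  choose u hopen hsub hne using fun K : {K : Set X // IsCompact K} => hcon K.1 K.2
  have hcov := isKCover_range hopen hsub
  obtain ⟨K, hK⟩ := hf _ hcov
  exact hne K _ hcov hK.symm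

theorem PlayerIWinsCompactOpen.playerIIWinsG1KO {len : Ordinal}
    (h : PlayerIWinsCompactOpen X len) : PlayerIIWinsG1KO X len := by
  classical
  obtain ⟨S, hcomp, hwin⟩ := h
  have hpick : ∀ (ξ : Ordinal) (hξ : ξ < len) (u : (η : Ordinal) → η < ξ → Set X)
      (C : Set (Set X)), ∃ U, IsKCover C → U ∈ C ∧ S ξ hξ u ⊆ U := by
    intro ξ hξ u C
    by_cases hC : IsKCover C
    · obtain ⟨U, hU, hSU⟩ := hC.2 _ (hcomp ξ hξ u)
      exact ⟨U, fun _ => ⟨hU, hSU⟩⟩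
    · exact ⟨∅, fun h => absurd h hC⟩
  choose pick hpick using hpick
  let G : (ξ : Ordinal) → ((η : Ordinal) → η < ξ → Set X) → Set (Set X) → Set X :=
    fun ξ u C => if hξ : ξ < len then pick ξ hξ u C else ∅
  have hG : ∀ (p : Ordinal → Set (Set X)) (ξ : Ordinal) (hξ : ξ < len), IsKCover (p ξ) →
      recSeq G p ξ ∈ p ξ ∧ S ξ hξ (fun η _ => recSeq G p η) ⊆ recSeq G p ξ := by
    intro p ξ hξ hp
    have heq : recSeq G p ξ = pick ξ hξ (fun η _ => recSeq G p η) (p ξ) :=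
      (recSeq_eq G p ξ).trans (dif_pos hξ)
    rw [heq]
    exact hpick ξ hξ _ _ hp
  refine ⟨fun ξ _ c => recSeq G (fun η => if hη : η ≤ ξ then c η hη else ∅) ξ, ?_, ?_⟩
  · intro ξ hξ c hc
    have := (hG (fun η => if hη : η ≤ ξ then c η hη else ∅) ξ hξ
      (by simpa using hc ξ le_rfl)).1
    simpa using this
  · intro p hp
    have hcover := hwin (recSeq G p) fun ξ hξ =>
      ⟨(hp ξ hξ).1.1 _ (hG p ξ hξ (hp ξ hξ)).1, (hG p ξ hξ (hp ξ hξ)).2⟩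
    refine Set.eq_univ_of_forall fun x => ?_
    have hx : x ∈ ⋃ ξ : Ordinal, ⋃ _ : ξ < len, recSeq G p ξ := hcover ▸ Set.mem_univ x
    obtain ⟨ξ, hξ, hx⟩ := Set.mem_iUnion₂.1 hx
    refine ⟨_, ⟨ξ, hξ, rfl⟩, ?_⟩
    beta_reduce
    rwa [recSeq_congr G (q := p) ξ fun η hη => dif_pos hη]

theorem PlayerIIWinsG1KO.playerIWinsCompactOpen {len : Ordinal}
    (h : PlayerIIWinsG1KO X len) : PlayerIWinsCompactOpen X len := by
  classical
  obtain ⟨F, hmem, hwin⟩ := h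
  let snoc : (ξ : Ordinal) → ((η : Ordinal) → η < ξ → Set (Set X)) → Set (Set X) →
      (η : Ordinal) → η ≤ ξ → Set (Set X) :=
    fun ξ c C η _ => if hη : η < ξ then c η hη else C
  have hK : ∀ (ξ : Ordinal) (hξ : ξ < len) (c : (η : Ordinal) → η < ξ → Set (Set X)),
      ∃ K : Set X, IsCompact K ∧ ((∀ η hη, IsKCover (c η hη)) →
        ∀ U, IsOpen U → K ⊆ U → ∃ C, IsKCover C ∧ F ξ hξ (snoc ξ c C) = U) := by
    intro ξ hξ c
    by_cases hc : ∀ η hη, IsKCover (c η hη)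
    · obtain ⟨K, hK, hKU⟩ := exists_isCompact_forall_exists_isKCover
        (fun C => F ξ hξ (snoc ξ c C)) (fun C hC => by
          have := hmem ξ hξ (snoc ξ c C) (fun η _ => by
            by_cases hη : η < ξ
            · simpa [snoc, hη] using hc η hη
            · simpa [snoc, hη] using hC)
          simpa [snoc] using this)
      exact ⟨K, hK, fun _ => hKU⟩
    · exact ⟨∅, isCompact_empty, fun h => absurd h hc⟩
  choose K hcomp hK using hK
  have hpick : ∀ (ξ : Ordinal) (c : (η : Ordinal) → η < ξ → Set (Set X)) (U : Set X),
      ∃ C, IsKCover C ∧ ((∀ η hη, IsKCover (c η hη)) → IsOpen U → ∀ hξ : ξ < len,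
        K ξ hξ c ⊆ U → F ξ hξ (snoc ξ c C) = U) := by
    intro ξ c U
    by_cases hgood : (∀ η hη, IsKCover (c η hη)) ∧ IsOpen U ∧ ∃ hξ : ξ < len, K ξ hξ c ⊆ U
    · obtain ⟨hc, hU, hξ, hKU⟩ := hgood
      obtain ⟨C, hC, hFC⟩ := hK ξ hξ c hc U hU hKU
      exact ⟨C, hC, fun _ _ _ _ => hFC⟩
    · exact ⟨{Set.univ}, isKCover_singleton_univ,
        fun hc hU hξ hKU => absurd ⟨hc, hU, hξ, hKU⟩ hgood⟩
  choose G hGcov hG using hpick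
  refine ⟨fun ξ hξ u => K ξ hξ fun η _ =>
    recSeq G (fun ζ => if hζ : ζ < ξ then u ζ hζ else ∅) η, fun ξ hξ u => hcomp ξ hξ _, ?_⟩
  intro U hU
  have hcov : ∀ ξ, IsKCover (recSeq G U ξ) := fun ξ => by
    rw [recSeq_eq]
    exact hGcov _ _ _
  have hF : ∀ (ξ : Ordinal) (hξ : ξ < len), F ξ hξ (fun η _ => recSeq G U η) = U ξ := by
    intro ξ hξ
    have hsub : K ξ hξ (fun η _ => recSeq G U η) ⊆ U ξ := by
      convert (hU ξ hξ).2 using 2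
      funext η hη
      exact recSeq_congr G η fun ζ hζ => by simp [hζ.trans_lt hη]
    rw [← hG ξ _ (U ξ) (fun η _ => hcov η) (hU ξ hξ).1 hξ hsub]
    congr 1
    funext η hη
    rcases hη.lt_or_eq with hlt | rfl
    · simp [snoc, hlt]
    · simpa [snoc] using recSeq_eq G U η
  refine Set.eq_univ_of_forall fun x => ?_
  obtain ⟨V, ⟨ξ, hξ, rfl⟩, hx⟩ :=
    (hwin (recSeq G U) fun ξ _ => hcov ξ).symm ▸ Set.mem_univ x
  rw [hF ξ hξ] at hx
  exact Set.mem_iUnion₂.2 ⟨ξ, hξ, hx⟩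

end Games

/-- For any infinite cardinal `κ`, player II has a winning strategy in `G₁^κ(𝒦,𝒪)` on `X`
iff player I has a winning strategy in the compact-open game of length `κ` on `X`. -/
theorem stmt7 {X : Type*} [TopologicalSpace X] (κ : Cardinal) (hκ : Cardinal.aleph0 ≤ κ) :
    PlayerIIWinsG1KO X κ.ord ↔ PlayerIWinsCompactOpen X κ.ord :=
  ⟨fun h => h.playerIWinsCompactOpen, fun h => h.playerIIWinsG1KO⟩
end

section
/- Let X be a Tychonoff (completely regular Hausdorff) space and let κ be an infinite regular cardinal. If player II has a winning strategy in the game G_fin^κ(𝒪,𝒪) on X, then player I has a winning strategy in the compact-open game of length 2^{<κ} on X. -/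
open Cardinal Set

/-- Player II has a winning strategy in the game `G_fin^len(𝒪,𝒪)` on `X`:
there is a strategy `σ` assigning to each nonempty sequence `(𝒰_η)_{η ≤ ξ}` (`ξ < len`)
of open covers a finite subset of the last cover `𝒰_ξ`, such that for every `len`-sequence
of open covers played by player I, the union of the chosen finite families covers `X`. -/
def PlayerIIWinsGfinOO (X : Type*) [TopologicalSpace X] (len : Ordinal) : Prop :=
  ∃ σ : (ξ : Ordinal) → ξ < len → ((η : Ordinal) → η ≤ ξ → Set (Set X)) → Set (Set X),
    (∀ (ξ : Ordinal) (hξ : ξ < len) (h : (η : Ordinal) → η ≤ ξ → Set (Set X)),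
      (∀ η hη, IsOpenCover (h η hη)) → σ ξ hξ h ⊆ h ξ le_rfl ∧ (σ ξ hξ h).Finite) ∧
    (∀ U : Ordinal → Set (Set X), (∀ ξ < len, IsOpenCover (U ξ)) →
      ⋃₀ (⋃ ξ : Ordinal, ⋃ _ : ξ < len, σ ξ ‹ξ < len› fun η _ => U η) = Set.univ)

universe u v

theorem mk_Iio_ord_toType_lt {c : Cardinal} (i : c.ord.ToType) : #(Iio i) < c := by
  simpa using mk_Iio_lt i

theorem exists_forall_lt_of_mk_lt_cof {ι : Type*} {o : Ordinal} (h : #ι < o.cof)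
    (f : ι → o.ToType) : ∃ a, ∀ i, f i < a := by
  have hf : ¬ IsCofinal (range f) := fun hc => by
    have := Order.cof_le hc
    rw [Ordinal.cof_toType] at this
    exact (this.trans mk_range_le).not_gt h
  obtain ⟨a, ha⟩ := not_isCofinal_iff.1 hf
  exact ⟨a, fun i => ha _ (mem_range_self i)⟩

theorem le_two_powerlt (κ : Cardinal) : κ ≤ 2 ^< κ :=
  le_of_forall_lt fun c hc => (cantor c).trans_le (le_powerlt 2 hc)

/-- For regular `κ`, the cofinality of `2 ^< κ` is at least `κ`. -/
theorem le_cof_ord_two_powerlt {κ : Cardinal} (hκ : κ.IsRegular) : κ ≤ (2 ^< κ).ord.cof := by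
  by_cases h : ∃ c < κ, 2 ^ c = 2 ^< κ
  · obtain ⟨c, hc, hcμ⟩ := h
    refine le_of_forall_lt fun d hd => ?_
    rcases lt_or_ge d ℵ₀ with hd' | hd'
    · refine hd'.trans_le (Ordinal.aleph0_le_cof_iff.2 (Ordinal.one_lt_cof_iff.2 ?_))
      exact isSuccLimit_ord (hκ.aleph0_le.trans (le_two_powerlt κ))
    · have h1 : (2 : Cardinal) ^ max c d = 2 ^< κ :=
        le_antisymm (le_powerlt _ (max_lt hc hd))
          (hcμ ▸ power_le_power_left two_ne_zero (le_max_left _ _))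
      rw [← h1]
      exact (le_max_right c d).trans_lt
        (lt_cof_ord_power (hd'.trans (le_max_right _ _)) one_lt_two)
  · push Not at h
    by_contra! hlt
    rw [← Ordinal.cof_toType] at hlt
    obtain ⟨s, hs, hsc⟩ := Order.exists_cof_eq (2 ^< κ).ord.ToType
    have h1 : ∀ i : s, ∃ c < κ, #(Iio i.1) < 2 ^ c := by
      intro i
      by_contra! hc
      exact (mk_Iio_ord_toType_lt i.1).not_ge (powerlt_le.2 hc)
    choose c hc hcs using h1
    have hsup : iSup c < κ :=
      iSup_lt_of_lt_cof_ord (by rwa [hκ.cof_ord, hsc]) hc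
    have hlt' : (2 : Cardinal) ^ iSup c < 2 ^< κ := (le_powerlt 2 hsup).lt_of_ne (h _ hsup)
    obtain ⟨i, hi, hxi⟩ := hs (Ordinal.ToType.mk ⟨_, ord_lt_ord.2 hlt'⟩)
    have h3 : #(Iio (Ordinal.ToType.mk ⟨_, ord_lt_ord.2 hlt'⟩)) = 2 ^ iSup c := by
      change Ordinal.card (Ordinal.typein (α := (2 ^< κ).ord.ToType) (· < ·) _) = _
      exact (congrArg _ (Ordinal.typein_enum _ _)).trans (card_ord _)
    have h4 : (2 : Cardinal) ^ iSup c ≤ #(Iio i) := h3 ▸ mk_le_mk_of_subset (Iio_subset_Iio hxi)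
    exact (h4.trans_lt (hcs ⟨i, hi⟩)).not_ge
      (power_le_power_left two_ne_zero (le_ciSup bddAbove_of_small _))

theorem power_le_two_powerlt {κ c : Cardinal} (hκ : κ.IsRegular) (hc : c < κ) :
    κ ^ c ≤ 2 ^< κ := by
  have key (f : c.out → κ.ord.ToType) : ∃ a, ∀ x, f x < a :=
    exists_forall_lt_of_mk_lt_cof (by rwa [mk_out, hκ.cof_ord]) f
  choose a ha using key
  let F : (c.out → κ.ord.ToType) → Σ a : κ.ord.ToType, (c.out → Iio a) :=
    fun f => ⟨a f, fun x => ⟨f x, ha f x⟩⟩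
  have hF : Function.Injective F := by
    intro f g hfg
    funext x
    have : ∀ p q : Σ a : κ.ord.ToType, (c.out → Iio a), p = q → (p.2 x).1 = (q.2 x).1 := by
      rintro p q rfl; rfl
    exact this _ _ hfg
  have h1 := mk_le_of_injective hF
  rw [mk_sigma] at h1
  simp only [← power_def, mk_out, mk_ord_toType] at h1
  refine h1.trans ((sum_le_sum _ (fun _ => 2 ^< κ) fun b => ?_).trans ?_)
  · calc #(Iio b) ^ c ≤ (2 ^ #(Iio b)) ^ c := power_le_power_right (cantor _).le
      _ = 2 ^ (#(Iio b) * c) := (power_mul ..).symm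
      _ ≤ _ := le_powerlt 2 (mul_lt_of_lt hκ.aleph0_le (mk_Iio_ord_toType_lt b) hc)
  · have h := le_two_powerlt κ
    rw [sum_const, lift_id, lift_id, mk_ord_toType,
      mul_eq_max_of_aleph0_le_left hκ.aleph0_le (ne_of_gt (hκ.pos.trans_le h)), max_eq_right h]

/-- Sequences of length `< κ` with entries from `κ` can be coded injectively by elements of
`2 ^< κ`. -/
theorem exists_encode_seq {κ : Cardinal.{v}} (hκ : κ.IsRegular) :
    ∃ e : Ordinal.{v} → (Ordinal.{v} → κ.ord.ToType) → (2 ^< κ).ord.ToType,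
      (∀ α b b', (∀ η < α, b η = b' η) → e α b = e α b') ∧
      ∀ α < κ.ord, ∀ β < κ.ord, ∀ b b', e α b = e β b' → α = β ∧ ∀ η < α, b η = b' η := by
  have hμ : ℵ₀ ≤ 2 ^< κ := hκ.aleph0_le.trans (le_two_powerlt κ)
  have h1 (a : κ.ord.ToType) : Nonempty ((Iio a → κ.ord.ToType) ↪ (2 ^< κ).ord.ToType) := by
    rw [← le_def, ← power_def, mk_ord_toType, mk_ord_toType]
    exact power_le_two_powerlt hκ (mk_Iio_ord_toType_lt a)
  have h2 : Nonempty (κ.ord.ToType × (2 ^< κ).ord.ToType ↪ (2 ^< κ).ord.ToType) := by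
    rw [← le_def, mk_prod, lift_id, lift_id, mk_ord_toType, mk_ord_toType]
    exact (mul_le_mul_left (le_two_powerlt κ) _).trans (mul_eq_self hμ).le
  let j (a : κ.ord.ToType) := (h1 a).some
  let p := h2.some
  obtain ⟨d⟩ : Nonempty (2 ^< κ).ord.ToType := by
    rw [← mk_ne_zero_iff, mk_ord_toType]
    exact (aleph0_pos.trans_le hμ).ne'
  let code (a : κ.ord.ToType) (b : Ordinal.{v} → κ.ord.ToType) : (2 ^< κ).ord.ToType :=
    p (a, j a fun c => b c.1.toOrd)
  refine ⟨fun α b => if h : α < κ.ord then code (.mk ⟨α, h⟩) b else d, ?_, ?_⟩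
  · intro α b b' hb
    dsimp only
    split_ifs with h
    · have : (fun c : Iio (Ordinal.ToType.mk ⟨α, h⟩) => b c.1.toOrd) =
          fun c => b' c.1.toOrd := by
        funext c
        refine hb _ ?_
        have := c.2
        rwa [mem_Iio, ← OrderIso.symm_apply_lt] at this
      simp only [code, this]
    · rfl
  · intro α hα β hβ b b' h
    simp only [hα, hβ, dif_pos, code, EmbeddingLike.apply_eq_iff_eq, Prod.mk.injEq] at h
    obtain ⟨h', h⟩ := h
    obtain rfl : α = β := congrArg Subtype.val h'
    refine ⟨rfl, fun η hη => ?_⟩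
    have := congrFun ((j _).injective h) ⟨.mk ⟨η, hη.trans hα⟩, Ordinal.ToType.mk.lt_iff_lt.2 hη⟩
    simpa using this

/-- Injective indexing of the sequences of length `< κ` with entries from `κ` by the ordinals
below `2 ^< κ` under which every sequence comes after all of its proper initial segments. -/
theorem exists_index_seq {κ : Cardinal.{v}} (hκ : κ.IsRegular) :
    ∃ e : Ordinal.{v} → (Ordinal.{v} → κ.ord.ToType) → Ordinal.{v},
      (∀ α b, e α b < (2 ^< κ).ord) ∧
      (∀ α b b', (∀ η < α, b η = b' η) → e α b = e α b') ∧
      (∀ α < κ.ord, ∀ b, ∀ β < α, e β b < e α b) ∧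
      ∀ α < κ.ord, ∀ β < κ.ord, ∀ b b', e α b = e β b' → α = β ∧ ∀ η < α, b η = b' η := by
  obtain ⟨c, hc, hc'⟩ := exists_encode_seq hκ
  have hμ : ℵ₀ ≤ 2 ^< κ := hκ.aleph0_le.trans (le_two_powerlt κ)
  let M := (2 ^< κ).ord.ToType
  obtain ⟨p⟩ : Nonempty (M × M ↪ M) := by
    rw [← le_def, mk_prod, lift_id, mk_ord_toType]
    exact (mul_eq_self hμ).le
  have hunb (m a : M) : ∃ n, a < p (m, n) := by
    by_contra! h
    have : #M ≤ #(Iic a) := mk_le_of_injective (f := fun n => (⟨p (m, n), h n⟩ : Iic a))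
      fun x y hxy => (Prod.mk.inj (p.injective (congrArg Subtype.val hxy))).2
    refine this.not_gt ?_
    rw [← Iio_insert]
    refine (mk_insert_le).trans_lt ?_
    rw [mk_ord_toType]
    exact add_lt_of_lt hμ (mk_Iio_ord_toType_lt a) (one_lt_aleph0.trans_le hμ)
  have hstep (α : Ordinal.{v}) (hα : α < κ.ord) (m : M) (f : ∀ β < α, M) :
      ∃ n, ∀ β hβ, f β hβ < p (m, n) := by
    obtain ⟨a, ha⟩ := exists_forall_lt_of_mk_lt_cof (ι := α.ToType) (o := (2 ^< κ).ord)
      ((by simpa using lt_ord.1 hα : #α.ToType < κ).trans_le (le_cof_ord_two_powerlt hκ))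
      (fun β => f β.toOrd β.toOrd.2)
    obtain ⟨n, hn⟩ := hunb m a
    refine ⟨n, fun β hβ => ?_⟩
    simpa using (ha (.mk ⟨β, hβ⟩)).trans hn
  have hstep' (α : Ordinal.{v}) (m : M) (f : ∀ β < α, M) :
      ∃ n, α < κ.ord → ∀ β hβ, f β hβ < p (m, n) := by
    by_cases hα : α < κ.ord
    · exact (hstep α hα m f).imp fun _ h _ => h
    · exact ⟨m, fun h => absurd h hα⟩
  choose g hg using hstep'
  let idx (b : Ordinal.{v} → κ.ord.ToType) : Ordinal.{v} → M :=
    WellFoundedLT.fix fun α ih => p (c α b, g α (c α b) ih)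
  have hidx (b α) : idx b α = p (c α b, g α (c α b) fun β _ => idx b β) :=
    WellFoundedLT.fix_eq _ _
  refine ⟨fun α b => (idx b α).toOrd, fun α b => (idx b α).toOrd.2, ?_, ?_, ?_⟩
  · intro α b b' h
    dsimp only
    congr 2
    induction α using WellFoundedLT.induction with
    | ind α ih =>
      rw [hidx, hidx, hc α b b' h]
      congr 3
      funext β hβ
      exact ih β hβ fun η hη => h η (hη.trans hβ)
  · intro α hα b β hβ
    have := hg α (c α b) (fun β _ => idx b β) hα β hβ
    rw [← hidx] at this
    simpa using this
  · intro α hα β hβ b b' h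
    refine hc' α hα β hβ b b' ?_
    have : idx b α = idx b' β := Ordinal.ToType.mk.symm.injective (Subtype.ext h)
    rw [hidx, hidx] at this
    exact congrArg Prod.fst (p.injective this)

section Cover

variable {X : Type u} [TopologicalSpace X]

theorem isOpenCover_singleton_univ : IsOpenCover {(Set.univ : Set X)} :=
  ⟨by simp, by simp⟩

theorem IsOpenCover.nonempty [Nonempty X] {C : Set (Set X)} (hC : IsOpenCover C) : C.Nonempty := by
  obtain ⟨x⟩ := ‹Nonempty X›
  obtain ⟨U, hU, -⟩ := mem_sUnion.1 (hC.2 ▸ mem_univ x)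
  exact ⟨U, hU⟩

theorem IsOpenCover.exists_subcover_indexed [Nonempty X] {κ : Cardinal.{v}} (hκ : ℵ₀ ≤ κ)
    (hwin : PlayerIIWinsGfinOO X κ.ord) {C : Set (Set X)} (hC : IsOpenCover C) :
    ∃ g : κ.ord.ToType → Set X, (∀ j, g j ∈ C) ∧ ⋃ j, g j = Set.univ := by
  obtain ⟨σ, hσ, hσwin⟩ := hwin
  have hfin (a : Iio κ.ord) := hσ a a.2 (fun _ _ => C) fun _ _ => hC
  have henum (a : Iio κ.ord) : ∃ f : ℕ → Set X, (∀ n, f n ∈ C) ∧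
      σ a a.2 (fun _ _ => C) ⊆ range f := by
    obtain ⟨V, hV⟩ := hC.nonempty
    obtain ⟨f, hf⟩ := ((hfin a).2.insert V).countable.exists_eq_range (insert_nonempty _ _)
    refine ⟨f, fun n => ?_, hf ▸ subset_insert _ _⟩
    have : f n ∈ insert V _ := hf ▸ mem_range_self n
    exact insert_subset hV (hfin a).1 this
  choose f hfC hf using henum
  obtain ⟨i⟩ : Nonempty (κ.ord.ToType ≃ κ.ord.ToType × ULift.{v} ℕ) := by
    rw [← Cardinal.eq, mk_prod]
    simp [hκ]
  refine ⟨fun j => f (i j).1.toOrd (i j).2.down, fun j => hfC _ _, ?_⟩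
  refine eq_univ_of_forall fun x => ?_
  have hx := mem_univ x
  rw [← hσwin (fun _ => C) fun _ _ => hC] at hx
  simp only [mem_sUnion, mem_iUnion] at hx
  obtain ⟨V, ⟨ξ, hξ, hV⟩, hxV⟩ := hx
  obtain ⟨n, hn⟩ := hf ⟨ξ, hξ⟩ hV
  refine mem_iUnion.2 ⟨i.symm (.mk ⟨ξ, hξ⟩, ⟨n⟩), ?_⟩
  simpa [hn] using hxV

/-- The points which lie in the closure of the selection `τ C` for every open cover `C`. -/
def selectionCore (τ : Set (Set X) → Set (Set X)) : Set X :=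
  ⋂ C, ⋂ _ : IsOpenCover C, closure (⋃₀ τ C)

theorem isCompact_selectionCore [RegularSpace X] {τ : Set (Set X) → Set (Set X)}
    (hτ : ∀ C, IsOpenCover C → τ C ⊆ C ∧ (τ C).Finite) : IsCompact (selectionCore τ) := by
  have hclosed : IsClosed (selectionCore τ) :=
    isClosed_iInter fun _ => isClosed_iInter fun _ => isClosed_closure
  refine isCompact_of_finite_subcover fun {ι} V hVo hV => ?_
  set C : Set (Set X) := {W | IsOpen W ∧
    (closure W ⊆ (selectionCore τ)ᶜ ∨ ∃ i, closure W ⊆ V i)} with hCdef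
  have hC : IsOpenCover C := by
    refine ⟨fun W hW => hW.1, eq_univ_of_forall fun x => ?_⟩
    have hreg : ∀ O : Set X, IsOpen O → x ∈ O → ∃ W, IsOpen W ∧ x ∈ W ∧ closure W ⊆ O := by
      intro O hO hx
      obtain ⟨T, hT, hTc, hTO⟩ := exists_mem_nhds_isClosed_subset (hO.mem_nhds hx)
      exact ⟨interior T, isOpen_interior, mem_interior_iff_mem_nhds.2 hT,
        (closure_minimal interior_subset hTc).trans hTO⟩
    by_cases hx : x ∈ selectionCore τ
    · obtain ⟨i, hi⟩ := mem_iUnion.1 (hV hx)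
      obtain ⟨W, hW, hxW, hWi⟩ := hreg _ (hVo i) hi
      exact ⟨W, ⟨hW, .inr ⟨i, hWi⟩⟩, hxW⟩
    · obtain ⟨W, hW, hxW, hWi⟩ := hreg _ hclosed.isOpen_compl hx
      exact ⟨W, ⟨hW, .inl hWi⟩, hxW⟩
  obtain ⟨hsub, hfin⟩ := hτ C hC
  obtain ⟨t, ht⟩ : ∃ t : Set ι, t.Finite ∧ ∀ W ∈ τ C,
      closure W ⊆ (selectionCore τ)ᶜ ∨ ∃ i ∈ t, closure W ⊆ V i := by
    classical
    have h : ∀ W ∈ τ C, ∃ t : Set ι, t.Finite ∧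
        (closure W ⊆ (selectionCore τ)ᶜ ∨ ∃ i ∈ t, closure W ⊆ V i) := by
      intro W hW
      rcases (hsub hW).2 with h | ⟨i, hi⟩
      · exact ⟨∅, finite_empty, .inl h⟩
      · exact ⟨{i}, finite_singleton i, .inr ⟨i, rfl, hi⟩⟩
    choose! t ht ht' using h
    refine ⟨⋃ W ∈ τ C, t W, hfin.biUnion ht, fun W hW => (ht' W hW).imp_right ?_⟩
    rintro ⟨i, hi, h⟩
    exact ⟨i, mem_biUnion hW hi, h⟩
  refine ⟨ht.1.toFinset, fun x hx => ?_⟩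
  have hxC : x ∈ closure (⋃₀ τ C) := mem_iInter₂.1 hx C hC
  rw [hfin.closure_sUnion] at hxC
  obtain ⟨W, hW, hxW⟩ := mem_iUnion₂.1 hxC
  rcases ht.2 W hW with h | ⟨i, hi, h⟩
  · exact absurd hx (h hxW)
  · exact mem_biUnion (ht.1.mem_toFinset.2 hi) (h hxW)

theorem exists_covers_of_selectionCore_subset [Nonempty X] {κ : Cardinal.{v}} (hκ : ℵ₀ ≤ κ)
    (hwin : PlayerIIWinsGfinOO X κ.ord) {τ : Set (Set X) → Set (Set X)} {U : Set X}
    (hU : IsOpen U) (hτU : selectionCore τ ⊆ U) :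
    ∃ g : κ.ord.ToType → Set (Set X), (∀ j, IsOpenCover (g j)) ∧
      ∀ x ∉ U, ∃ j, x ∉ ⋃₀ τ (g j) := by
  have hC : IsOpenCover (insert U {W | ∃ C, IsOpenCover C ∧ W = (closure (⋃₀ τ C))ᶜ}) := by
    refine ⟨?_, eq_univ_of_forall fun x => ?_⟩
    · rintro W (rfl | ⟨C, -, rfl⟩)
      exacts [hU, isClosed_closure.isOpen_compl]
    · by_cases hx : x ∈ selectionCore τ
      · exact ⟨U, .inl rfl, hτU hx⟩
      · simp only [selectionCore, mem_iInter, not_forall] at hx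
        obtain ⟨C, hC, hx⟩ := hx
        exact ⟨_, .inr ⟨C, hC, rfl⟩, hx⟩
  obtain ⟨g, hgC, hg⟩ := hC.exists_subcover_indexed hκ hwin
  have h (j) : ∃ C, IsOpenCover C ∧ (g j = U ∨ g j = (closure (⋃₀ τ C))ᶜ) := by
    rcases hgC j with h | ⟨C, hC, h⟩
    · exact ⟨_, isOpenCover_singleton_univ, .inl h⟩
    · exact ⟨C, hC, .inr h⟩
  choose c hc hgc using h
  refine ⟨c, hc, fun x hx => ?_⟩
  obtain ⟨j, hj⟩ := mem_iUnion.1 (hg ▸ mem_univ x)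
  refine ⟨j, fun hxj => ?_⟩
  rcases hgc j with h | h
  · exact hx (h ▸ hj)
  · exact (h ▸ hj : x ∈ (closure (⋃₀ τ (c j)))ᶜ) (subset_closure hxj)

end Cover

/-- If `X` is Tychonoff and player II has a winning strategy in `G_fin^κ(𝒪,𝒪)` for an
infinite regular cardinal `κ`, then player I has a winning strategy in the compact-open
game of length `2^{<κ}` on `X`. -/
theorem stmt8 {X : Type*} [TopologicalSpace X] [T35Space X]
    (κ : Cardinal) (hκ : κ.IsRegular)
    (hwin : PlayerIIWinsGfinOO X κ.ord) :
    PlayerIWinsCompactOpen X (Cardinal.powerlt 2 κ).ord := by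
  classical
  rcases isEmpty_or_nonempty X with hX | hX
  · exact ⟨fun _ _ _ => ∅, fun _ _ _ => isCompact_empty, fun _ _ => Subsingleton.elim _ _⟩
  obtain ⟨e, heμ, hecongr, hemono, heinj⟩ := exists_index_seq hκ
  obtain ⟨σ, hσ, hσwin⟩ := id hwin
  let τ (α : Ordinal) (p : Ordinal → Set (Set X)) (C : Set (Set X)) : Set (Set X) :=
    if h : α < κ.ord then σ α h fun η _ => Function.update p α C η else ∅
  have hτ α p (hp : ∀ η, IsOpenCover (p η)) C (hC : IsOpenCover C) :
      τ α p C ⊆ C ∧ (τ α p C).Finite := by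
    by_cases h : α < κ.ord
    · have := hσ α h (fun η _ => Function.update p α C η) fun η _ => by
        rcases eq_or_ne η α with rfl | hη
        · simpa
        · simpa [hη] using hp η
      simpa [τ, h] using this
    · simp [τ, h]
  have hG (α p U) : ∃ g : κ.ord.ToType → Set (Set X), (∀ j, IsOpenCover (g j)) ∧
      (IsOpen U → selectionCore (τ α p) ⊆ U → ∀ x ∉ U, ∃ j, x ∉ ⋃₀ τ α p (g j)) := by
    by_cases h : IsOpen U ∧ selectionCore (τ α p) ⊆ U
    · obtain ⟨g, hg, hg'⟩ :=
        exists_covers_of_selectionCore_subset hκ.aleph0_le hwin h.1 h.2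
      exact ⟨g, hg, fun _ _ => hg'⟩
    · exact ⟨fun _ => {Set.univ}, fun _ => isOpenCover_singleton_univ, fun h1 h2 => absurd ⟨h1, h2⟩ h⟩
  choose G hGcover hG using hG
  -- the open covers played along the branch `b` when the responses of II are given by `H`
  let P (H : Ordinal → Set X) (b : Ordinal → κ.ord.ToType) : Ordinal → Set (Set X) :=
    WellFoundedLT.fix fun α ih =>
      G α (fun η => if h : η < α then ih η h else {Set.univ}) (H (e α b)) (b α)
  let hist (H : Ordinal → Set X) (b : Ordinal → κ.ord.ToType) (α : Ordinal) :
    Ordinal → Set (Set X) := fun η => if η < α then P H b η else {Set.univ}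
  have hP H b α : P H b α = G α (hist H b α) (H (e α b)) (b α) :=
    (WellFoundedLT.fix_eq _ _).trans rfl
  have hPcover H b α : IsOpenCover (P H b α) := hP H b α ▸ hGcover _ _ _ _
  have hhistcover H b α η : IsOpenCover (hist H b α η) := by
    dsimp only [hist]
    split_ifs
    exacts [hPcover _ _ _, isOpenCover_singleton_univ]
  have hhist_congr H H' b b' α (hb : ∀ η < α, b η = b' η)
      (hH : ∀ η < α, H (e η b) = H' (e η b)) : hist H b α = hist H' b' α := by
    induction α using WellFoundedLT.induction with
    | ind α ih =>
      funext η
      by_cases hη : η < α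
      · simp only [hist, hη, if_true]
        rw [hP, hP, ih η hη (fun ζ hζ => hb ζ (hζ.trans hη)) (fun ζ hζ => hH ζ (hζ.trans hη)),
          hb η hη, hH η hη, hecongr η b b' fun ζ hζ => hb ζ (hζ.trans hη)]
      · simp [hist, hη]
  let ext (ξ : Ordinal) (h : (η : Ordinal) → η < ξ → Set X) (η : Ordinal) : Set X :=
    if hη : η < ξ then h η hη else ∅
  let S (ξ : Ordinal) (h : (η : Ordinal) → η < ξ → Set X) : Set X :=
    if hξ : ∃ q : Ordinal × (Ordinal → κ.ord.ToType), q.1 < κ.ord ∧ e q.1 q.2 = ξ then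
      selectionCore (τ hξ.choose.1 (hist (ext ξ h) hξ.choose.2 hξ.choose.1))
    else ∅
  have hS (U : Ordinal → Set X) (α) (hα : α < κ.ord) (b) :
      S (e α b) (fun η _ => U η) = selectionCore (τ α (hist U b α)) := by
    have hξ : ∃ q : Ordinal × (Ordinal → κ.ord.ToType), q.1 < κ.ord ∧ e q.1 q.2 = e α b :=
      ⟨(α, b), hα, rfl⟩
    simp only [S, dif_pos hξ]
    obtain ⟨h1, h2⟩ := hξ.choose_spec
    generalize hξ.choose = q at h1 h2
    obtain ⟨β, b'⟩ := q
    obtain ⟨rfl, hb⟩ := heinj _ h1 _ hα _ _ h2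
    congr 2
    refine hhist_congr _ _ _ _ _ hb fun η hη => ?_
    have := h2 ▸ hemono _ h1 b' η hη
    simp [ext, this]
  refine ⟨fun ξ _ h => S ξ h, fun ξ _ h => ?_, fun U hU => ?_⟩
  · dsimp only [S]
    split_ifs with hξ
    · exact isCompact_selectionCore (hτ _ _ fun η => hhistcover _ _ _ _)
    · exact isCompact_empty
  refine eq_univ_of_forall fun x => ?_
  by_contra hx
  simp only [mem_iUnion, not_exists] at hx
  have hstep α (hα : α < κ.ord) b :
      ∃ j, x ∉ ⋃₀ τ α (hist U b α) (G α (hist U b α) (U (e α b)) j) := by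
    obtain ⟨h1, h2⟩ := hU _ (heμ α b)
    exact hG α _ _ h1 (hS U α hα b ▸ h2) x (hx _ (heμ α b))
  have hstep' α b :
      ∃ j, α < κ.ord → x ∉ ⋃₀ τ α (hist U b α) (G α (hist U b α) (U (e α b)) j) := by
    by_cases hα : α < κ.ord
    · exact (hstep α hα b).imp fun _ h _ => h
    · exact ⟨b 0, fun h => absurd h hα⟩
  choose pick hpick using hstep'
  obtain ⟨d⟩ : Nonempty κ.ord.ToType := nonempty_ord_toType hκ.ne_zero
  let B : Ordinal → κ.ord.ToType := WellFoundedLT.fix fun α ih =>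
    pick α fun η => if h : η < α then ih η h else d
  have hB α : B α = pick α fun η => if η < α then B η else d :=
    (WellFoundedLT.fix_eq _ _).trans rfl
  have hxB α (hα : α < κ.ord) : x ∉ ⋃₀ σ α hα fun η _ => P U B η := by
    have h := hpick α (fun η => if η < α then B η else d) hα
    rw [← hB, hecongr α _ B (by simp +contextual),
      hhist_congr U U _ B α (by simp +contextual) (fun _ _ => rfl), ← hP] at h
    have hτP : τ α (hist U B α) (P U B α) = σ α hα fun η _ => P U B η := by
      refine (dif_pos hα).trans (congrArg (σ α hα) ?_)
      funext η hη
      rcases hη.eq_or_lt with rfl | hη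
      · simp
      · simp [hη.ne, hist, hη]
    rwa [hτP] at h
  have hxu := mem_univ x
  rw [← hσwin (P U B) fun α _ => hPcover _ _ _] at hxu
  simp only [mem_sUnion, mem_iUnion] at hxu
  obtain ⟨V, ⟨α, hα, hV⟩, hxV⟩ := hxu
  exact hxB α hα ⟨V, hV, hxV⟩
end
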